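/- Let j : V → M be an elementary embedding of the set-theoretic universe into a transitive class M, and let X, Y be transitive sets with Y ⊆ j(X). Then the map h(A) = j(A) ∩ Y^{<ω}, for A ⊆ X^{<ω}, is a homomorphism of 𝒫-structures from 𝒫_X to 𝒫_Y. -/

import Mathlib

open FirstOrder

namespace WVP

/-- `tup X k`: the set of `k`-tuples (as lists) of elements of the ZF-set `X`. -/
def tup (X : ZFSet) (k : ℕ) : Set (List ZFSet) := {l | l.length = k ∧ ∀ z ∈ l, z ∈ X}

/-- `finTup X`: the set of all finite tuples from `X`, i.e. `X^{<ω}`. -/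
def finTup (X : ZFSet) : Set (List ZFSet) := {l | ∀ z ∈ l, z ∈ X}

/-- `WFset A`: `A` is well-founded under the reverse of the proper-initial-segment
relation, i.e. there is no infinite chain `a₁ ⊊ a₂ ⊊ ⋯` of elements of `A`. -/
def WFset (A : Set (List ZFSet)) : Prop :=
  ¬ ∃ g : ℕ → List ZFSet, (∀ n, g n ∈ A) ∧ ∀ n, g n <+: g (n + 1) ∧ g n ≠ g (n + 1)

/-- The coordinate projection `(x₁,…,x_k) ↦ (x_{i₁},…,x_{i_j})` (0-based indices). -/
def proj (is : List ℕ) (l : List ZFSet) : List ZFSet := is.map fun i => l.getD i ∅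

/-- The inverse image operator `Proj⁻¹_{k,(i₁,…,i_j)}` of the coordinate projection
`proj is : X^k → X^j`, mapping subsets of `X^j` to subsets of `X^k`. -/
def ProjInv (X : ZFSet) (k : ℕ) (is : List ℕ) (A : Set (List ZFSet)) : Set (List ZFSet) :=
  {l | l ∈ tup X k ∧ proj is l ∈ A}

/-- The bounded projection operator `BP_k` on subsets of `X^{k+1}`:
`BP_k(A) = {(x₁,…,x_{k+1}) ∈ X^{k+1} : ∃ z ∈ x_{k+1}, (x₁,…,x_k,z) ∈ A}`. -/
def BP (X : ZFSet) (k : ℕ) (A : Set (List ZFSet)) : Set (List ZFSet) :=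
  {l | l ∈ tup X (k + 1) ∧ ∃ z, z ∈ l.getLastD ∅ ∧ l.dropLast ++ [z] ∈ A}

/-- A homomorphism of 𝒫-structures `𝒫_X → 𝒫_Y`: a Boolean algebra homomorphism
`𝒫(X^{<ω}) → 𝒫(Y^{<ω})` sending `X^k` to `Y^k`, preserving the well-foundedness
predicate `WF` (forward direction), and commuting with the inverse-projection
operators `Proj⁻¹` and the bounded projection operators `BP_k`. -/
structure IsPHom (X Y : ZFSet) (h : Set (List ZFSet) → Set (List ZFSet)) : Prop where
  subset_finTup : ∀ A ⊆ finTup X, h A ⊆ finTup Y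
  map_inter : ∀ A ⊆ finTup X, ∀ B ⊆ finTup X, h (A ∩ B) = h A ∩ h B
  map_compl : ∀ A ⊆ finTup X, h (finTup X \ A) = finTup Y \ h A
  map_const : ∀ k, h (tup X k) = tup Y k
  map_wf : ∀ A ⊆ finTup X, WFset A → WFset (h A)
  map_projInv : ∀ (j k : ℕ) (is : List ℕ), is.length = j → (∀ i ∈ is, i < k) →
    ∀ A ⊆ tup X j, h (ProjInv X k is A) = ProjInv Y k is (h A)
  map_bp : ∀ (k : ℕ), ∀ A ⊆ tup X (k + 1), h (BP X k A) = BP Y k (h A)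

/-- The type of relation symbols of the language of set theory: a single binary
relation (membership). -/
inductive memRel : ℕ → Type
  | mem : memRel 2

/-- The first-order language with a single binary relation symbol `∈`. -/
def ZFLang : FirstOrder.Language := ⟨fun _ => Empty, memRel⟩

instance : ZFLang.Structure ZFSet where
  funMap := fun f _ => f.elim
  RelMap := fun r x => match r with | .mem => x 0 ∈ x 1

instance (M : Set ZFSet) : ZFLang.Structure M where
  funMap := fun f _ => f.elim
  RelMap := fun r x => match r with | .mem => (x 0 : ZFSet) ∈ (x 1 : ZFSet)

/-- `M` is a transitive class of ZF-sets. -/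
def ClassTransitive (M : Set ZFSet) : Prop := ∀ x ∈ M, ∀ y ∈ x, y ∈ M

/-- `j : V → M` is an elementary embedding of the set-theoretic universe into the
class `M` (elementary with respect to the language of set theory). -/
def Elementary (M : Set ZFSet) (j : ZFSet → ZFSet) : Prop :=
  ∃ hj : ∀ x, j x ∈ M, ∀ (n : ℕ) (φ : ZFLang.Formula (Fin n)) (v : Fin n → ZFSet),
    φ.Realize v ↔ φ.Realize fun i => (⟨j (v i), hj (v i)⟩ : M)

attribute [local instance] Classical.propDecidable

noncomputable instance (n : ℕ) (F : (Fin n → ZFSet) → ZFSet) : ZFSet.Definable n F :=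
  Classical.allZFSetDefinable F

/-- Coding of a finite tuple of ZF-sets as a single ZF-set, by iterated
Kuratowski pairing: `⟨⟩ ↦ ∅`, `(x, l) ↦ pair x (code l)`. -/
def listCode : List ZFSet → ZFSet
  | [] => ∅
  | x :: l => ZFSet.pair x (listCode l)

/-- The ZF-set `X^k` of (codes of) `k`-tuples from `X`. -/
def kTupZ (X : ZFSet) : ℕ → ZFSet
  | 0 => {∅}
  | k + 1 => ZFSet.sep (fun z => ∃ x ∈ X, ∃ t ∈ kTupZ X k, z = ZFSet.pair x t)
      (ZFSet.powerset (ZFSet.powerset (X ∪ kTupZ X k)))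

/-- The ZF-set `X^{<ω}` of (codes of) all finite tuples from `X`. -/
noncomputable def finTupZ (X : ZFSet) : ZFSet :=
  ZFSet.sUnion (ZFSet.range fun k : ℕ => kTupZ X k)

/-- The ZF-set coding a collection `A` of finite tuples from `X`. -/
noncomputable def codeZ (X : ZFSet) (A : Set (List ZFSet)) : ZFSet :=
  ZFSet.sep (fun z => ∃ l ∈ A, z = listCode l) (finTupZ X)

/-! ### Definable predicate pairs -/

section helpers

universe u v

/-- `P` over the universe and `Q` over `M` are defined by one and the same formula. -/
def Dfn (M : Set ZFSet.{v}) {α : Type} (P : (α → ZFSet.{u}) → Prop) (Q : (α → M) → Prop) : Prop :=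
  ∃ φ : ZFLang.Formula α, (∀ w, φ.Realize w ↔ P w) ∧ ∀ w, φ.Realize w ↔ Q w

variable {M : Set ZFSet.{v}} {α β : Type}

/-- the membership symbol -/
def memSym : ZFLang.Relations 2 := memRel.mem

theorem Dfn.mem (a b : α) : Dfn.{u} M (fun w => w a ∈ w b)
    (fun w => (w a : ZFSet) ∈ (w b : ZFSet)) :=
  ⟨Language.Relations.formula memSym
      ![Language.Term.var a, Language.Term.var b],
    fun w => Language.Formula.realize_rel.trans Iff.rfl,
    fun w => Language.Formula.realize_rel.trans Iff.rfl⟩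

theorem Dfn.eq (a b : α) : Dfn.{u} M (fun w => w a = w b)
    (fun w => (w a : ZFSet) = (w b : ZFSet)) :=
  ⟨Language.Term.equal (Language.Term.var a) (Language.Term.var b),
    fun w => by rw [Language.Formula.realize_equal]; exact Iff.rfl,
    fun w => by rw [Language.Formula.realize_equal]; exact Subtype.ext_iff⟩

variable {P P' : (α → ZFSet.{u}) → Prop} {Q Q' : (α → M) → Prop}

theorem Dfn.not (h : Dfn M P Q) : Dfn M (fun w => ¬ P w) (fun w => ¬ Q w) := by
  obtain ⟨φ, h1, h2⟩ := h
  exact ⟨φ.not, fun w => by rw [Language.Formula.realize_not, h1],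
    fun w => by rw [Language.Formula.realize_not, h2]⟩

theorem Dfn.imp (h : Dfn M P Q) (h' : Dfn M P' Q') :
    Dfn M (fun w => P w → P' w) (fun w => Q w → Q' w) := by
  obtain ⟨φ, h1, h2⟩ := h
  obtain ⟨φ', h1', h2'⟩ := h'
  exact ⟨φ.imp φ', fun w => by rw [Language.Formula.realize_imp, h1, h1'],
    fun w => by rw [Language.Formula.realize_imp, h2, h2']⟩

theorem Dfn.congr (h : Dfn M P Q) (h1 : ∀ w, P w ↔ P' w) (h2 : ∀ w, Q w ↔ Q' w) :
    Dfn M P' Q' := by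
  obtain ⟨φ, g1, g2⟩ := h
  exact ⟨φ, fun w => (g1 w).trans (h1 w), fun w => (g2 w).trans (h2 w)⟩

theorem Dfn.and (h : Dfn M P Q) (h' : Dfn M P' Q') :
    Dfn M (fun w => P w ∧ P' w) (fun w => Q w ∧ Q' w) :=
  (h.imp h'.not).not.congr (fun w => by tauto) (fun w => by tauto)

theorem Dfn.or (h : Dfn M P Q) (h' : Dfn M P' Q') :
    Dfn M (fun w => P w ∨ P' w) (fun w => Q w ∨ Q' w) :=
  (h.not.imp h').congr (fun w => by tauto) (fun w => by tauto)

theorem Dfn.iff (h : Dfn M P Q) (h' : Dfn M P' Q') :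
    Dfn M (fun w => P w ↔ P' w) (fun w => Q w ↔ Q' w) :=
  ((h.imp h').and (h'.imp h)).congr (fun w => by tauto) (fun w => by tauto)

theorem Dfn.all [Finite β] {P : (α ⊕ β → ZFSet.{u}) → Prop} {Q : (α ⊕ β → M) → Prop}
    (h : Dfn M P Q) :
    Dfn M (fun w => ∀ x : β → ZFSet.{u}, P (Sum.elim w x))
      (fun w => ∀ x : β → M, Q (Sum.elim w x)) := by
  obtain ⟨φ, h1, h2⟩ := h
  exact ⟨φ.iAlls β, fun w => by simp only [Language.Formula.realize_iAlls, h1],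
    fun w => by simp only [Language.Formula.realize_iAlls, h2]⟩

theorem Dfn.all1 {P : (α ⊕ Unit → ZFSet.{u}) → Prop} {Q : (α ⊕ Unit → M) → Prop}
    (h : Dfn M P Q) :
    Dfn M (fun w => ∀ x : ZFSet.{u}, P (Sum.elim w fun _ => x))
      (fun w => ∀ x : M, Q (Sum.elim w fun _ => x)) :=
  h.all.congr (fun w => ⟨fun g x => g fun _ => x, fun g x => g (x ())⟩)
    (fun w => ⟨fun g x => g fun _ => x, fun g x => g (x ())⟩)

theorem Dfn.ex1 {P : (α ⊕ Unit → ZFSet.{u}) → Prop} {Q : (α ⊕ Unit → M) → Prop}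
    (h : Dfn M P Q) :
    Dfn M (fun w => ∃ x : ZFSet.{u}, P (Sum.elim w fun _ => x))
      (fun w => ∃ x : M, Q (Sum.elim w fun _ => x)) :=
  h.not.all1.not.congr (fun w => by push Not; rfl) (fun w => by push Not; rfl)

theorem Dfn.allMem (is : List α) (c : α) : Dfn.{u} M (fun w => ∀ z ∈ is.map w, z ∈ w c)
    (fun w => ∀ z ∈ is.map (fun i => (w i : ZFSet)), z ∈ (w c : ZFSet)) := by
  induction is with
  | nil => exact (Dfn.eq c c).congr (fun _ => by simp) (fun _ => by simp)
  | cons i is ih => exact ((Dfn.mem i c).and ih).congr (fun w => by simp) (fun w => by simp)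



theorem Dfn.empty (hM : ClassTransitive M) (a : α) : Dfn.{u} M (fun w => w a = ∅)
    (fun w => (w a : ZFSet) = ∅) :=
  (Dfn.mem (Sum.inr ()) (Sum.inl a)).not.all1.congr
    (fun w => by simp [ZFSet.eq_empty])
    (fun w => by
      simp only [Sum.elim_inl, Sum.elim_inr, ZFSet.eq_empty]
      exact ⟨fun h y hy => h ⟨y, hM _ (w a).2 _ hy⟩ hy, fun h y => h y⟩)

theorem up_iff (z x y : ZFSet.{u}) :
    z = {x, y} ↔ x ∈ z ∧ y ∈ z ∧ ∀ t, t ∈ z → t = x ∨ t = y := by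
  constructor
  · rintro rfl; simp
  · rintro ⟨h1, h2, h3⟩
    ext t
    rw [ZFSet.mem_pair]
    exact ⟨h3 t, by rintro (rfl | rfl) <;> assumption⟩

theorem pair_iff (z x y : ZFSet.{u}) :
    z = ZFSet.pair x y ↔ (∃ t, t ∈ z ∧ t = {x, x}) ∧ (∃ t, t ∈ z ∧ t = {x, y}) ∧
      ∀ t, t ∈ z → t = {x, x} ∨ t = {x, y} := by
  have e : ({x, x} : ZFSet) = {x} := by ext; simp
  rw [ZFSet.pair, up_iff, e]
  simp

theorem Dfn.up (hM : ClassTransitive M) (a b c : α) : Dfn.{u} M (fun w => w a = {w b, w c})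
    (fun w => (w a : ZFSet) = {(w b : ZFSet), (w c : ZFSet)}) :=
  ((Dfn.mem b a).and ((Dfn.mem c a).and
    ((Dfn.mem (Sum.inr ()) (Sum.inl a)).imp
      ((Dfn.eq (Sum.inr ()) (Sum.inl b)).or (Dfn.eq (Sum.inr ()) (Sum.inl c)))).all1)).congr
    (fun w => (up_iff _ _ _).symm)
    (fun w => by
      rw [up_iff]
      simp only [Sum.elim_inl, Sum.elim_inr]
      exact and_congr_right fun _ => and_congr_right fun _ =>
        ⟨fun h y hy => h ⟨y, hM _ (w a).2 _ hy⟩ hy, fun h y => h y⟩)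

theorem Dfn.pair (hM : ClassTransitive M) (a b c : α) :
    Dfn.{u} M (fun w => w a = ZFSet.pair (w b) (w c))
    (fun w => (w a : ZFSet) = ZFSet.pair (w b : ZFSet) (w c : ZFSet)) :=
  (((Dfn.mem (Sum.inr ()) (Sum.inl a)).and
      (Dfn.up hM (Sum.inr ()) (Sum.inl b) (Sum.inl b))).ex1.and
    ((((Dfn.mem (Sum.inr ()) (Sum.inl a)).and
      (Dfn.up hM (Sum.inr ()) (Sum.inl b) (Sum.inl c))).ex1).and
    ((Dfn.mem (Sum.inr ()) (Sum.inl a)).imp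
      ((Dfn.up hM (Sum.inr ()) (Sum.inl b) (Sum.inl b)).or
        (Dfn.up hM (Sum.inr ()) (Sum.inl b) (Sum.inl c)))).all1)).congr
    (fun w => (pair_iff _ _ _).symm)
    (fun w => by
      rw [pair_iff]
      simp only [Sum.elim_inl, Sum.elim_inr]
      refine and_congr ?_ (and_congr ?_ ?_)
      · exact ⟨fun ⟨t, h⟩ => ⟨t, h⟩, fun ⟨t, h⟩ => ⟨⟨t, hM _ (w a).2 _ h.1⟩, h⟩⟩
      · exact ⟨fun ⟨t, h⟩ => ⟨t, h⟩, fun ⟨t, h⟩ => ⟨⟨t, hM _ (w a).2 _ h.1⟩, h⟩⟩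
      · exact ⟨fun h y hy => h ⟨y, hM _ (w a).2 _ hy⟩ hy, fun h y => h y⟩)

theorem transfer {j : ZFSet.{u} → ZFSet.{v}} (hj : ∀ x, j x ∈ M)
    (he : ∀ (n : ℕ) (φ : ZFLang.Formula (Fin n)) (v : Fin n → ZFSet),
      φ.Realize v ↔ φ.Realize fun i => (⟨j (v i), hj (v i)⟩ : M))
    {n k : ℕ} {P : (Fin n ⊕ Fin k → ZFSet.{u}) → Prop} {Q : (Fin n ⊕ Fin k → M) → Prop}
    (h : Dfn M P Q) (p : Fin n → ZFSet.{u}) (hp : ∀ x, P (Sum.elim p x)) (x : Fin k → M) :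
    Q (Sum.elim (fun i => ⟨j (p i), hj (p i)⟩) x) := by
  obtain ⟨φ, h1, h2⟩ := h.all
  exact (h2 _).1 ((he n φ p).1 ((h1 p).2 hp)) x

/-- closure under codes -/
def Closed (M : Set ZFSet.{v}) : Prop :=
  ∅ ∈ M ∧ ∀ x ∈ M, ∀ y ∈ M, ZFSet.pair x y ∈ M

theorem closed_of (hM : ClassTransitive M) {j : ZFSet.{u} → ZFSet.{v}} (hj : ∀ x, j x ∈ M)
    (he : ∀ (n : ℕ) (φ : ZFLang.Formula (Fin n)) (v : Fin n → ZFSet),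
      φ.Realize v ↔ φ.Realize fun i => (⟨j (v i), hj (v i)⟩ : M)) : Closed M := by
  constructor
  · have := transfer hj he (n := 0) (k := 0) (Dfn.empty hM (Sum.inr ())).ex1 Fin.elim0
      (fun x => ⟨∅, rfl⟩) Fin.elim0
    obtain ⟨z, hz⟩ := this
    simp only [Sum.elim_inr] at hz
    rw [← hz]; exact z.2
  · intro x hx y hy
    have := transfer hj he (n := 0) (k := 2)
      (Dfn.pair hM (Sum.inr ()) (Sum.inl (Sum.inr 0)) (Sum.inl (Sum.inr 1))).ex1 Fin.elim0
      (fun x => ⟨ZFSet.pair (x 0) (x 1), rfl⟩) ![⟨x, hx⟩, ⟨y, hy⟩]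
    obtain ⟨z, hz⟩ := this
    simp at hz
    rw [← hz]; exact z.2

theorem Closed.code (hc : Closed M) : ∀ l : List ZFSet.{v}, (∀ z ∈ l, z ∈ M) → listCode l ∈ M
  | [], _ => hc.1
  | x :: l, h => hc.2 x (h x (by simp)) _ (Closed.code hc l fun z hz => h z (by simp [hz]))

theorem Dfn.isCode (hM : ClassTransitive M) (hc : Closed M) (is : List α) :
    ∀ a : α, Dfn.{u} M (fun w => w a = listCode (is.map w))
      (fun w => (w a : ZFSet) = listCode (is.map fun i => (w i : ZFSet))) := by
  suffices H : ∀ (β : Type) (f : α → β) (a : β),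
      Dfn.{u} M (fun w => w a = listCode (is.map fun i => w (f i)))
      (fun w => (w a : ZFSet) = listCode (is.map fun i => (w (f i) : ZFSet))) from
    fun a => H α id a
  induction is with
  | nil => exact fun β f a => Dfn.empty hM a
  | cons i is ih =>
    intro β f a
    refine ((ih (β ⊕ Unit) (fun i => Sum.inl (f i)) (Sum.inr ())).and
      (Dfn.pair hM (Sum.inl a) (Sum.inl (f i)) (Sum.inr ()))).ex1.congr (fun w => ?_) (fun w => ?_)
    · simp [listCode]
    · simp only [Sum.elim_inl, Sum.elim_inr, List.map_cons, listCode]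
      constructor
      · rintro ⟨x, h1, h2⟩; rw [h2, h1]
      · intro h
        refine ⟨⟨_, hc.code (is.map fun i => (w (f i) : ZFSet)) ?_⟩, rfl, h⟩
        simp only [List.mem_map]
        rintro z ⟨i, -, rfl⟩; exact (w _).2

theorem Dfn.codeMem (hM : ClassTransitive M) (hc : Closed M) (is : List α) (a : α) :
    Dfn.{u} M (fun w => listCode (is.map w) ∈ w a)
      (fun w => listCode (is.map fun i => (w i : ZFSet)) ∈ (w a : ZFSet)) := by
  refine ((Dfn.mem (Sum.inr ()) (Sum.inl a)).and
    (Dfn.isCode hM hc (is.map Sum.inl) (Sum.inr ()))).ex1.congr (fun w => ?_) (fun w => ?_)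
  · simp [Function.comp_def]
  · simp only [Sum.elim_inl, Sum.elim_inr, List.map_map, Function.comp_def]
    constructor
    · rintro ⟨x, h1, h2⟩; rwa [← h2]
    · intro h
      exact ⟨⟨_, hM _ (w a).2 _ h⟩, h, rfl⟩

theorem listCode_inj : ∀ l l' : List ZFSet.{u}, listCode l = listCode l' → l = l'
  | [], [], _ => rfl
  | [], x :: l, h => by
    exfalso
    simp only [listCode] at h
    have : ({x} : ZFSet) ∈ (∅ : ZFSet) := by rw [h]; simp [ZFSet.pair]
    simp at this
  | x :: l, [], h => by
    exfalso
    simp only [listCode] at h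
    have : ({x} : ZFSet) ∈ (∅ : ZFSet) := by rw [← h]; simp [ZFSet.pair]
    simp at this
  | x :: l, y :: l', h => by
    simp only [listCode, ZFSet.pair_inj] at h
    rw [h.1, listCode_inj l l' h.2]

theorem code_mem_kTupZ (X : ZFSet.{u}) : ∀ l : List ZFSet.{u}, (∀ z ∈ l, z ∈ X) →
    listCode l ∈ kTupZ X l.length
  | [], _ => by simp [listCode, kTupZ]
  | x :: l, h => by
    have hl := code_mem_kTupZ X l fun z hz => h z (by simp [hz])
    have hx := h x (by simp)
    simp only [listCode, kTupZ, List.length_cons, ZFSet.mem_sep]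
    refine ⟨?_, x, hx, _, hl, rfl⟩
    rw [ZFSet.mem_powerset]
    intro y hy
    rw [ZFSet.mem_powerset]
    intro z hz
    rw [ZFSet.mem_union]
    simp only [ZFSet.pair, ZFSet.mem_pair] at hy
    rcases hy with rfl | rfl
    · rw [ZFSet.mem_singleton] at hz; subst hz; exact Or.inl hx
    · rw [ZFSet.mem_pair] at hz
      rcases hz with rfl | rfl
      · exact Or.inl hx
      · exact Or.inr hl

theorem code_mem_codeZ {X : ZFSet.{0}} {A : Set (List ZFSet.{0})} (hA : A ⊆ finTup X)
    (l : List ZFSet.{0}) : listCode l ∈ codeZ X A ↔ l ∈ A := by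
  simp only [codeZ, ZFSet.mem_sep]
  constructor
  · rintro ⟨-, l', h, e⟩; rwa [listCode_inj _ _ e]
  · intro h
    refine ⟨?_, l, h, rfl⟩
    simp only [finTupZ, ZFSet.mem_sUnion, ZFSet.mem_range]
    exact ⟨_, ⟨_, rfl⟩, code_mem_kTupZ X l (hA h)⟩

theorem exists_rank {X : ZFSet.{0}} {A : Set (List ZFSet.{0})} (hA : A ⊆ finTup X)
    (hw : WFset A) : ∃ F : ZFSet.{0}, (∀ l ∈ A, ∃ p, listCode (p :: l) ∈ F) ∧
      ∀ l l' p p', listCode (p :: l) ∈ F → listCode (p' :: l') ∈ F → l <+: l' → l ≠ l' →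
        p' ∈ p := by
  let S := {l // l ∈ A}
  have hS : Small.{0} S := by
    refine small_of_injective (β := codeZ X A)
      (f := fun l : S => ⟨listCode l.1, (code_mem_codeZ hA _).2 l.2⟩) ?_
    intro l l' h
    exact Subtype.ext (listCode_inj _ _ (congrArg Subtype.val h))
  let r : S → S → Prop := fun b a => a.1 <+: b.1 ∧ a.1 ≠ b.1
  have wf : WellFounded r := by
    rw [wellFounded_iff_isEmpty_descending_chain]
    refine ⟨fun ⟨f, hf⟩ => hw ⟨fun n => (f n).1, fun n => (f n).2, fun n => hf n⟩⟩
  let f : S → ZFSet.{0} := wf.fix fun a ih =>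
    ZFSet.range (fun b : {b : S // r b a} => ih b.1 b.2)
  have hf : ∀ a b, r b a → f b ∈ f a := by
    intro a b h
    have : f a = ZFSet.range (fun b : {b : S // r b a} => f b.1) := wf.fix_eq _ _
    rw [this, ZFSet.mem_range]
    exact ⟨⟨b, h⟩, rfl⟩
  refine ⟨ZFSet.range (fun a : S => listCode (f a :: a.1)), fun l hl => ⟨f ⟨l, hl⟩, ?_⟩, ?_⟩
  · rw [ZFSet.mem_range]; exact ⟨⟨l, hl⟩, rfl⟩
  · intro l l' p p' h h' h1 h2
    rw [ZFSet.mem_range] at h h'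
    obtain ⟨a, ha⟩ := h
    obtain ⟨b, hb⟩ := h'
    have ha := listCode_inj _ _ ha
    have hb := listCode_inj _ _ hb
    simp only [List.cons.injEq] at ha hb
    obtain ⟨rfl, rfl⟩ := ha
    obtain ⟨rfl, rfl⟩ := hb
    exact hf _ _ ⟨h1, h2⟩

theorem exists_fn (l : List ZFSet.{v}) (h : ∀ z ∈ l, z ∈ M) :
    ∃ x : Fin l.length → M, (List.finRange l.length).map (fun i => (x i : ZFSet)) = l :=
  ⟨fun i => ⟨l.get i, h _ (List.get_mem l i)⟩, by
    apply List.ext_get <;> simp⟩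

theorem exists_fn' (l : List ZFSet.{v}) (h : ∀ z ∈ l, z ∈ M) {k : ℕ} (hk : l.length = k) :
    ∃ x : Fin k → M, (List.finRange k).map (fun i => (x i : ZFSet)) = l := by
  subst hk
  exact exists_fn l h

theorem proj_map {k : ℕ} (is : List (Fin k)) (y : Fin k → ZFSet.{v}) :
    proj (is.map Fin.val) ((List.finRange k).map y) = is.map y := by
  simp [proj]

theorem last_map {k : ℕ} (y : Fin (k + 1) → ZFSet.{v}) :
    ((List.finRange (k + 1)).map y).getLastD ∅ = y (Fin.last k) := by
  rw [List.finRange_succ_last]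
  simp

/-- the list of all tuple variables -/
def tv (n k : ℕ) : List (Fin n ⊕ Fin k) := (List.finRange k).map Sum.inr

theorem tv_map {D : Type*} {E : Type*} (g : D → E) {n k : ℕ} (p : Fin n → D) (x : Fin k → D) :
    (tv n k).map (fun i => g (Sum.elim p x i)) = (List.finRange k).map fun i => g (x i) := by
  simp [tv, Function.comp_def]

theorem tv_map' {D : Type*} {n k : ℕ} (p : Fin n → D) (x : Fin k → D) :
    (tv n k).map (Sum.elim p x) = (List.finRange k).map x := by
  simp [tv]

end helpers

/-- Let `j : V → M` be an elementary embedding of the set-theoretic universe into a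
transitive class `M`, and let `X`, `Y` be transitive sets with `Y ⊆ j(X)`. Then the
map `h(A) = j(A) ∩ Y^{<ω}` (for `A ⊆ X^{<ω}`; here a tuple `l` from `Y` belongs to
`h(A)` iff its code belongs to `j` of the ZF-set coding `A`) is a homomorphism of
𝒫-structures from `𝒫_X` to `𝒫_Y`. -/
theorem derived_hom_isPHom (M : Set ZFSet) (j : ZFSet → ZFSet)
    (hM : ClassTransitive M) (hj : Elementary M j)
    (X Y : ZFSet) (hX : X.IsTransitive) (hY : Y.IsTransitive) (hYjX : Y ⊆ j X) :
    IsPHom X Y fun A => {l | l ∈ finTup Y ∧ listCode l ∈ j (codeZ X A)} := by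
  obtain ⟨hj, he⟩ := hj
  have hc := closed_of hM hj he
  have hYM : ∀ l ∈ finTup Y, ∀ z ∈ l, z ∈ M := fun l hl z hz => hM _ (hj X) _ (hYjX (hl z hz))
  have hYX : ∀ l ∈ finTup Y, ∀ z ∈ l, z ∈ j X := fun l hl z hz => hYjX (hl z hz)
  have hsub : ∀ k, tup X k ⊆ finTup X := fun k l h => h.2
  -- a set of `k`-tuples is sent to a set of `k`-tuples
  have hlen : ∀ k, ∀ A ⊆ tup X k, ∀ l ∈ finTup Y, listCode l ∈ j (codeZ X A) → l.length = k := by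
    intro k A hA l hl h
    by_contra hne
    obtain ⟨x, hx⟩ := exists_fn l (hYM l hl)
    have := transfer hj he (n := 1) (k := l.length)
      (Dfn.codeMem hM hc (tv 1 _) (Sum.inl 0)).not ![codeZ X A] (fun x => by
        rw [tv_map']
        simp only [Sum.elim_inl, Matrix.cons_val_zero]
        rw [code_mem_codeZ (hA.trans (hsub k))]
        intro h
        exact hne (by simpa using (hA h).1)) x
    rw [tv_map Subtype.val, hx] at this
    exact this h
  constructor
  · intro A _ l hl
    exact hl.1
  · intro A hA B hB
    ext l
    simp only [Set.mem_ofPred_eq, Set.mem_inter_iff]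
    suffices H : l ∈ finTup Y → (listCode l ∈ j (codeZ X (A ∩ B)) ↔
      listCode l ∈ j (codeZ X A) ∧ listCode l ∈ j (codeZ X B)) by tauto
    intro hl
    obtain ⟨x, hx⟩ := exists_fn l (hYM l hl)
    have := transfer hj he (n := 3) (k := l.length)
      ((Dfn.codeMem hM hc (tv 3 _) (Sum.inl 0)).iff
        ((Dfn.codeMem hM hc (tv 3 _) (Sum.inl 1)).and
        (Dfn.codeMem hM hc (tv 3 _) (Sum.inl 2)))) ![codeZ X (A ∩ B), codeZ X A, codeZ X B]
      (fun x => by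
        rw [tv_map']
        change _ ∈ codeZ X (A ∩ B) ↔ _ ∈ codeZ X A ∧ _ ∈ codeZ X B
        rw [code_mem_codeZ hA, code_mem_codeZ hB,
          code_mem_codeZ (Set.inter_subset_left.trans hA)]
        rfl) x
    rw [tv_map Subtype.val, hx] at this
    exact this
  · intro A hA
    ext l
    simp only [Set.mem_ofPred_eq, Set.mem_sdiff]
    suffices H : l ∈ finTup Y → (listCode l ∈ j (codeZ X (finTup X \ A)) ↔
      ¬ listCode l ∈ j (codeZ X A)) by tauto
    intro hl
    obtain ⟨x, hx⟩ := exists_fn l (hYM l hl)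
    have := transfer hj he (n := 3) (k := l.length)
      ((Dfn.allMem (tv 3 _) (Sum.inl 2)).imp
        ((Dfn.codeMem hM hc (tv 3 _) (Sum.inl 0)).iff
        (Dfn.codeMem hM hc (tv 3 _) (Sum.inl 1)).not)) ![codeZ X (finTup X \ A), codeZ X A, X]
      (fun x => by
        rw [tv_map']
        change (∀ z ∈ _, z ∈ X) → (_ ∈ codeZ X (finTup X \ A) ↔ ¬ _ ∈ codeZ X A)
        rw [code_mem_codeZ hA, code_mem_codeZ Set.sdiff_subset]
        intro h
        exact and_iff_right h) x
    rw [tv_map Subtype.val, hx] at this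
    exact this (hYX l hl)
  · intro k
    ext l
    simp only [Set.mem_ofPred_eq]
    constructor
    · intro h
      exact ⟨hlen k _ subset_rfl l h.1 h.2, h.1⟩
    · rintro ⟨rfl, hl⟩
      refine ⟨hl, ?_⟩
      obtain ⟨x, hx⟩ := exists_fn l (hYM l hl)
      have := transfer hj he (n := 2) (k := l.length)
        ((Dfn.allMem (tv 2 _) (Sum.inl 1)).imp
          (Dfn.codeMem hM hc (tv 2 _) (Sum.inl 0))) ![codeZ X (tup X l.length), X]
        (fun x => by
          rw [tv_map']
          change (∀ z ∈ _, z ∈ X) → (_ ∈ codeZ X _)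
          rw [code_mem_codeZ (hsub _)]
          intro h
          exact ⟨by simp, h⟩) x
      rw [tv_map Subtype.val, hx] at this
      exact this (hYX l hl)
  · rintro A hA hw ⟨g, hg, hch⟩
    obtain ⟨F, hF1, hF2⟩ := exists_rank hA hw
    have h1 : ∀ n, ∃ p ∈ M, listCode (p :: g n) ∈ j F := by
      intro n
      obtain ⟨hl, hm⟩ := hg n
      obtain ⟨x, hx⟩ := exists_fn _ (hYM _ hl)
      have := transfer hj he (n := 2) (k := (g n).length)
        ((Dfn.codeMem hM hc (tv 2 _) (Sum.inl 0)).imp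
          (Dfn.codeMem hM hc (Sum.inr () :: (tv 2 _).map Sum.inl) (Sum.inl (Sum.inl 1))).ex1)
        ![codeZ X A, F]
        (fun x => by
          simp only [List.map_cons, List.map_map, Sum.elim_comp_inl]
          rw [tv_map']
          change _ ∈ codeZ X _ → ∃ p, listCode (p :: _) ∈ F
          rw [code_mem_codeZ hA]
          exact hF1 _) x
      simp only [List.map_cons, List.map_map, Function.comp_def, Sum.elim_inl, Sum.elim_inr] at this
      rw [tv_map Subtype.val, hx] at this
      obtain ⟨p, hp⟩ := this hm
      exact ⟨p, p.2, hp⟩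
    choose p hpM hp using h1
    have h2 : ∀ n, p (n + 1) ∈ p n := by
      intro n
      obtain ⟨hl, hm⟩ := hg (n + 1)
      obtain ⟨hpre, hne⟩ := hch n
      obtain ⟨x, hx⟩ := exists_fn _ (hYM _ hl)
      have hlt : (g n).length < (g (n + 1)).length := by
        rcases hpre.length_le.lt_or_eq with h | h
        · exact h
        · exact absurd (hpre.eq_of_length h) hne
      have := transfer hj he (n := 1) (k := (g (n + 1)).length)
        ((Dfn.codeMem hM hc (Sum.inl (Sum.inr ()) ::
            (((tv 1 _).take (g n).length).map Sum.inl).map Sum.inl)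
            (Sum.inl (Sum.inl (Sum.inl 0)))).imp
          ((Dfn.codeMem hM hc (Sum.inr () :: ((tv 1 _).map Sum.inl).map Sum.inl)
            (Sum.inl (Sum.inl (Sum.inl 0)))).imp
            (Dfn.mem (Sum.inr ()) (Sum.inl (Sum.inr ()))))).all1.all1
        ![F]
        (fun x p p' => by
          simp only [List.map_cons, List.map_map, Sum.elim_comp_inl, Sum.elim_inl, Sum.elim_inr,
            ← Function.comp_assoc, List.map_take]
          rw [tv_map']
          intro h h'
          refine hF2 _ _ _ _ h h' (List.take_prefix _ _) ?_
          intro e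
          have := congrArg List.length e
          simp at this
          omega) x ⟨_, hpM n⟩ ⟨_, hpM (n + 1)⟩
      simp only [List.map_cons, List.map_map, Function.comp_def, Sum.elim_inl, Sum.elim_inr,
        List.map_take] at this
      rw [tv_map Subtype.val, hx, ← List.prefix_iff_eq_take.1 hpre] at this
      exact this (hp n) (hp (n + 1))
    exact (wellFounded_iff_isEmpty_descending_chain.1 ZFSet.mem_wf).false ⟨p, h2⟩
  · intro m k is him hik A hA
    have hPI : ProjInv X k is A ⊆ tup X k := fun l h => h.1
    obtain ⟨is, rfl⟩ : ∃ is' : List (Fin k), is = is'.map Fin.val :=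
      ⟨is.pmap Fin.mk hik, by simp [List.map_pmap]⟩
    ext l
    simp only [Set.mem_ofPred_eq, ProjInv, tup]
    suffices H : l ∈ finTup Y → l.length = k → (listCode l ∈ j (codeZ X (ProjInv X k (is.map Fin.val) A)) ↔
        listCode (proj (is.map Fin.val) l) ∈ j (codeZ X A) ∧
          proj (is.map Fin.val) l ∈ finTup Y) by
      constructor
      · rintro ⟨hl, h⟩
        have hk := hlen k _ hPI l hl h
        have := (H hl hk).1 h
        exact ⟨⟨hk, hl⟩, this.2, this.1⟩
      · rintro ⟨⟨hk, hl⟩, h, h'⟩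
        exact ⟨hl, (H hl hk).2 ⟨h', h⟩⟩
    intro hl hk
    obtain ⟨x, hx⟩ := exists_fn' l (hYM l hl) hk
    have hpx : proj (is.map Fin.val) l = is.map fun i => (x i : ZFSet) := by
      rw [← hx, proj_map]
    have hfin : proj (is.map Fin.val) l ∈ finTup Y := by
      rw [hpx]
      intro z hz
      apply hl
      rw [← hx]
      obtain ⟨i, -, rfl⟩ := List.mem_map.1 hz
      exact List.mem_map.2 ⟨i, List.mem_finRange i, rfl⟩
    rw [and_iff_left hfin, hpx]
    have := transfer hj he (n := 3) (k := k)
      ((Dfn.allMem (tv 3 _) (Sum.inl 2)).imp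
        ((Dfn.codeMem hM hc (tv 3 _) (Sum.inl 0)).iff
        (Dfn.codeMem hM hc (is.map Sum.inr) (Sum.inl 1))))
      ![codeZ X (ProjInv X k (is.map Fin.val) A), codeZ X A, X]
      (fun x => by
        rw [tv_map', List.map_map, Sum.elim_comp_inr]
        change (∀ z ∈ _, z ∈ X) → (_ ∈ codeZ X (ProjInv X k (is.map Fin.val) A) ↔ _ ∈ codeZ X A)
        rw [code_mem_codeZ (hA.trans (hsub _)), code_mem_codeZ (hPI.trans (hsub _))]
        intro h
        simp only [ProjInv, Set.mem_ofPred_eq, proj_map]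
        exact and_iff_right ⟨by simp, h⟩) x
    simp only [List.map_map, Function.comp_def, Sum.elim_inr] at this
    rw [tv_map Subtype.val, hx] at this
    exact this (hYX l hl)
  · intro k A hA
    have hB : BP X k A ⊆ tup X (k + 1) := fun l h => h.1
    ext l
    simp only [Set.mem_ofPred_eq, BP, tup]
    suffices H : l ∈ finTup Y → l.length = k + 1 → (listCode l ∈ j (codeZ X (BP X k A)) ↔
        ∃ z, z ∈ l.getLastD ∅ ∧ l.dropLast ++ [z] ∈ finTup Y ∧
          listCode (l.dropLast ++ [z]) ∈ j (codeZ X A)) by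
      constructor
      · rintro ⟨hl, h⟩
        have hk := hlen (k + 1) _ hB l hl h
        exact ⟨⟨hk, hl⟩, (H hl hk).1 h⟩
      · rintro ⟨⟨hk, hl⟩, h⟩
        exact ⟨hl, (H hl hk).2 h⟩
    intro hl hk
    obtain ⟨x, hx⟩ := exists_fn' l (hYM l hl) hk
    have hlast : l.getLastD ∅ = (x (Fin.last k) : ZFSet) := by
      rw [← hx, last_map]
    have hxY : (x (Fin.last k) : ZFSet) ∈ Y := by
      apply hl
      rw [← hx]
      exact List.mem_map.2 ⟨_, List.mem_finRange _, rfl⟩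
    have := transfer hj he (n := 3) (k := k + 1)
      ((Dfn.allMem (tv 3 _) (Sum.inl 2)).imp
        ((Dfn.codeMem hM hc (tv 3 _) (Sum.inl 0)).iff
        ((Dfn.mem (Sum.inr ()) (Sum.inl (Sum.inr (Fin.last k)))).and
          (Dfn.codeMem hM hc ((tv 3 _).dropLast.map Sum.inl ++ [Sum.inr ()])
            (Sum.inl (Sum.inl 1)))).ex1))
      ![codeZ X (BP X k A), codeZ X A, X]
      (fun x => by
        simp only [List.map_append, List.map_cons, List.map_nil, List.map_map, Sum.elim_comp_inl,
          Sum.elim_inl, Sum.elim_inr, List.map_dropLast]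
        rw [tv_map']
        change (∀ z ∈ _, z ∈ X) → (_ ∈ codeZ X (BP X k A) ↔ ∃ z, _ ∧ _ ∈ codeZ X A)
        rw [code_mem_codeZ (hB.trans (hsub _))]
        simp only [code_mem_codeZ (hA.trans (hsub _))]
        intro h
        simp only [BP, Set.mem_ofPred_eq, last_map]
        exact and_iff_right ⟨by simp, h⟩) x
    simp only [List.map_append, List.map_cons, List.map_nil, List.map_map, Function.comp_def,
      Sum.elim_inl, Sum.elim_inr, List.map_dropLast] at this
    rw [tv_map Subtype.val, hx] at this
    refine (this (hYX l hl)).trans ?_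
    rw [hlast]
    constructor
    · rintro ⟨z, hz, h⟩
      refine ⟨z, hz, ?_, h⟩
      intro t ht
      rcases List.mem_append.1 ht with ht | ht
      · exact hl t (List.mem_of_mem_dropLast ht)
      · rw [List.mem_singleton.1 ht]
        exact hY _ hxY hz
    · rintro ⟨z, hz, -, h⟩
      exact ⟨⟨z, hM _ (x _).2 _ hz⟩, hz, h⟩

end WVP
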